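/- arXiv:2203.05730 — 2 statements merged into one kernel-verified Lean document; each statement's English description precedes it below -/
import Mathlib

section
/- Let a < b be real numbers, let f : [a,b] → ℝ be a continuous function attaining its maximum at a unique point x₀ ∈ (a,b), and assume f is twice differentiable on a neighborhood of x₀ with f''(x₀) ≠ 0 (hence f''(x₀) < 0). Let gₙ : [a,b] → ℂ be a sequence of continuous functions converging uniformly to a function g∞ with g∞(x₀) ≠ 0. Then the sums Sₙ = Σ_{j ∈ ℤ, a ≤ 2πj/n ≤ b} gₙ(2πj/n) e^{n f(2πj/n)} satisfy lim_{n→∞} Sₙ / (√n · e^{n f(x₀)}) = g∞(x₀) / √(−2π f''(x₀)). -/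
open Filter

open MeasureTheory Set in
theorem integral_floor_eq_sum (F : Finset ℤ) (h : ℤ → ℂ) :
    ∫ u : ℝ, (if ⌊u⌋ ∈ F then h ⌊u⌋ else 0) = ∑ j ∈ F, h j := by
  have key : (fun u : ℝ => if ⌊u⌋ ∈ F then h ⌊u⌋ else 0) =
      fun u => ∑ j ∈ F, (Ico (j : ℝ) (j + 1)).indicator (fun _ => h j) u := by
    ext u
    simp only [indicator_apply, mem_Ico, ← Int.floor_eq_iff]
    exact (Finset.sum_ite_eq F ⌊u⌋ h).symm
  rw [key, integral_finsetSum]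
  · exact Finset.sum_congr rfl fun j _ => by simp [integral_indicator_const]
  · intro j _
    exact (integrable_indicator_iff measurableSet_Ico).2
      (integrableOn_const (by simp) (by simp))

open MeasureTheory in
theorem integral_floor_mul_add_eq_sum (F : Finset ℤ) (h : ℤ → ℂ) {r : ℝ} (hr : 0 < r) (t : ℝ) :
    ∫ s : ℝ, (if ⌊r * s + t⌋ ∈ F then h ⌊r * s + t⌋ else 0) = (∑ j ∈ F, h j) / r := by
  rw [Measure.integral_comp_mul_left
      (fun y : ℝ => if ⌊y + t⌋ ∈ F then h ⌊y + t⌋ else 0) r,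
    integral_add_right_eq_self (fun y : ℝ => if ⌊y⌋ ∈ F then h ⌊y⌋ else 0) t,
    integral_floor_eq_sum, abs_of_pos (inv_pos.2 hr), Complex.real_smul, Complex.ofReal_inv,
    div_eq_inv_mul]

/-- Second-order Taylor expansion at a critical point, under pointwise second differentiability. -/
theorem tendsto_div_sq_of_hasDerivAt {f f' : ℝ → ℝ} {x₀ c : ℝ}
    (hf' : ∀ᶠ x in nhds x₀, HasDerivAt f (f' x) x) (hf'' : HasDerivAt f' c x₀)
    (h₀ : f' x₀ = 0) :
    Tendsto (fun x => (f x - f x₀) / (x - x₀) ^ 2) (nhdsWithin x₀ {x₀}ᶜ) (nhds (c / 2)) := by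
  obtain ⟨δ, hδ, hball⟩ := Metric.eventually_nhds_iff_ball.1 hf'
  have hx : x₀ ∈ Metric.ball x₀ δ := Metric.mem_ball_self hδ
  have ho : (fun x => (f x - c / 2 * (x - x₀) ^ 2) - (f x₀ - c / 2 * (x₀ - x₀) ^ 2))
      =o[nhdsWithin x₀ (Metric.ball x₀ δ)] fun x => (x - x₀) ^ (1 + 1) := by
    refine (convex_ball x₀ δ).isLittleO_pow_succ_real (f := fun x => f x - c / 2 * (x - x₀) ^ 2)
      (f' := fun x => f' x - c * (x - x₀)) hx (fun x hx => ?_) ?_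
    · have h1 : HasDerivAt (fun x => c / 2 * (x - x₀) ^ 2) (c * (x - x₀)) x := by
        have := ((((hasDerivAt_id x).sub_const x₀).pow 2).const_mul (c / 2))
        convert! this using 1
        simp
        ring
      exact ((hball x hx).sub h1).hasDerivWithinAt
    · have := (hasDerivAt_iff_isLittleO.1 hf'').mono
        (nhdsWithin_le_nhds (s := Metric.ball x₀ δ))
      simpa [h₀, mul_comm] using this
  rw [nhdsWithin_eq_nhds.2 (Metric.ball_mem_nhds x₀ hδ)] at ho
  have h2 := (ho.mono (nhdsWithin_le_nhds (s := {x₀}ᶜ))).tendsto_div_nhds_zero.add_const (c / 2)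
  rw [zero_add] at h2
  refine h2.congr' ?_
  filter_upwards [self_mem_nhdsWithin] with x hx
  have : x - x₀ ≠ 0 := sub_ne_zero.2 hx
  field_simp
  ring

theorem exists_quadratic_factor {a b x₀ : ℝ} (hx₀ : x₀ ∈ Set.Ioo a b)
    {f f' : ℝ → ℝ} {c : ℝ} (hf : ContinuousOn f (Set.Icc a b))
    (hmax : ∀ x ∈ Set.Icc a b, x ≠ x₀ → f x < f x₀)
    (hf' : ∀ᶠ x in nhds x₀, HasDerivAt f (f' x) x)
    (hf'' : HasDerivAt f' c x₀) (hc : c ≠ 0) :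
    c < 0 ∧ ∃ q : ℝ → ℝ, ContinuousOn q (Set.Icc a b) ∧ q x₀ = c / 2 ∧
      (∀ x, f x - f x₀ = q x * (x - x₀) ^ 2) ∧ ∃ κ > 0, ∀ x ∈ Set.Icc a b, q x ≤ -κ := by
  have hI : Set.Icc a b ∈ nhds x₀ := Icc_mem_nhds hx₀.1 hx₀.2
  have hloc : IsLocalMax f x₀ := by
    filter_upwards [hI] with x hx
    rcases eq_or_ne x x₀ with rfl | h
    · exact le_rfl
    · exact (hmax x hx h).le
  have ht := tendsto_div_sq_of_hasDerivAt hf' hf'' (hloc.hasDerivAt_eq_zero hf'.self_of_nhds)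
  have hc0 : c / 2 ≤ 0 := by
    refine le_of_tendsto ht ?_
    filter_upwards [nhdsWithin_le_nhds hloc] with x hx
    exact div_nonpos_of_nonpos_of_nonneg (sub_nonpos.2 hx) (sq_nonneg _)
  have hcneg : c < 0 := lt_of_le_of_ne (by linarith) hc
  let q : ℝ → ℝ := Function.update (fun x => (f x - f x₀) / (x - x₀) ^ 2) x₀ (c / 2)
  have hq0 : q x₀ = c / 2 := Function.update_self ..
  have hqne : ∀ x, x ≠ x₀ → q x = (f x - f x₀) / (x - x₀) ^ 2 :=
    fun x hx => Function.update_of_ne hx ..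
  have hqc : ContinuousOn q (Set.Icc a b) := by
    intro x hx
    rcases eq_or_ne x x₀ with rfl | h
    · exact (continuousAt_update_same.2 ht).continuousWithinAt
    · have h1 : ContinuousWithinAt (fun x => (f x - f x₀) / (x - x₀) ^ 2) (Set.Icc a b) x :=
        ((hf x hx).sub continuousWithinAt_const).div
          (by fun_prop) (pow_ne_zero 2 (sub_ne_zero.2 h))
      refine h1.congr_of_eventuallyEq ?_ (hqne x h)
      filter_upwards [nhdsWithin_le_nhds (isOpen_ne.mem_nhds h)] with y hy using hqne y hy
  have hqneg : ∀ x ∈ Set.Icc a b, q x < 0 := by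
    intro x hx
    rcases eq_or_ne x x₀ with rfl | h
    · rw [hq0]; linarith
    · rw [hqne x h]
      have : x - x₀ ≠ 0 := sub_ne_zero.2 h
      exact div_neg_of_neg_of_pos (sub_neg.2 (hmax x hx h)) (by positivity)
  obtain ⟨m, hm, hmm⟩ := isCompact_Icc.exists_isMaxOn ⟨x₀, mem_of_mem_nhds hI⟩ hqc
  refine ⟨hcneg, q, hqc, hq0, fun x => ?_, -q m, neg_pos.2 (hqneg m hm), fun x hx => ?_⟩
  · rcases eq_or_ne x x₀ with rfl | h
    · simp
    · rw [hqne x h, div_mul_cancel₀ _ (pow_ne_zero 2 (sub_ne_zero.2 h))]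
  · simpa using hmm hx

/-- The point of the grid `(2π/n)ℤ` lying at or just below `x₀ + 2πs/√n`. -/
noncomputable def gridPoint (x₀ : ℝ) (n : ℕ) (s : ℝ) : ℝ :=
  2 * Real.pi * ⌊Real.sqrt n * s + n * x₀ / (2 * Real.pi)⌋ / n

theorem abs_sqrt_mul_gridPoint_sub_le (x₀ s : ℝ) {n : ℕ} (hn : 0 < n) :
    |Real.sqrt n * (gridPoint x₀ n s - x₀) - 2 * Real.pi * s| ≤ 2 * Real.pi / Real.sqrt n := by
  set u := Real.sqrt n * s + n * x₀ / (2 * Real.pi) with hu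
  have hn' : (0 : ℝ) < n := Nat.cast_pos.2 hn
  have hr : 0 < Real.sqrt n := Real.sqrt_pos.2 hn'
  have hπ := Real.pi_pos
  have hid : Real.sqrt n * (gridPoint x₀ n s - x₀) - 2 * Real.pi * s =
      2 * Real.pi / Real.sqrt n * (⌊u⌋ - u) := by
    have hsq : (n : ℝ) = Real.sqrt n ^ 2 := (Real.sq_sqrt hn'.le).symm
    rw [gridPoint, ← hu]
    generalize (⌊u⌋ : ℝ) = w
    rw [hu]
    generalize Real.sqrt n = r at *
    rw [hsq]
    field_simp
    ring
  have h1 : |(⌊u⌋ : ℝ) - u| ≤ 1 := by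
    rw [abs_le]
    constructor <;> linarith [Int.floor_le u, Int.lt_floor_add_one u]
  rw [hid, abs_mul, abs_of_pos (by positivity)]
  exact mul_le_of_le_one_right (by positivity) h1

theorem tendsto_sqrt_natCast_atTop : Tendsto (fun n : ℕ => Real.sqrt n) atTop atTop :=
  Real.tendsto_sqrt_atTop.comp tendsto_natCast_atTop_atTop

theorem tendsto_sqrt_mul_gridPoint_sub (x₀ s : ℝ) :
    Tendsto (fun n : ℕ => Real.sqrt n * (gridPoint x₀ n s - x₀)) atTop
      (nhds (2 * Real.pi * s)) := by
  rw [tendsto_iff_dist_tendsto_zero]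
  refine squeeze_zero' (Eventually.of_forall fun _ => dist_nonneg) ?_
    (tendsto_sqrt_natCast_atTop.const_div_atTop (2 * Real.pi))
  filter_upwards [eventually_gt_atTop 0] with n hn
  exact abs_sqrt_mul_gridPoint_sub_le x₀ s hn

theorem tendsto_gridPoint (x₀ s : ℝ) :
    Tendsto (fun n : ℕ => gridPoint x₀ n s) atTop (nhds x₀) := by
  have h := ((tendsto_sqrt_mul_gridPoint_sub x₀ s).div_atTop
    tendsto_sqrt_natCast_atTop).add_const x₀
  rw [zero_add] at h
  refine h.congr' ?_
  filter_upwards [eventually_gt_atTop 0] with n hn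
  have hr : 0 < Real.sqrt n := Real.sqrt_pos.2 (Nat.cast_pos.2 hn)
  field_simp
  ring

theorem le_mul_gridPoint_sub_sq (x₀ s : ℝ) {n : ℕ} (hn : 0 < n) :
    2 * Real.pi ^ 2 * s ^ 2 - 4 * Real.pi ^ 2 ≤ n * (gridPoint x₀ n s - x₀) ^ 2 := by
  have h := abs_sqrt_mul_gridPoint_sub_le x₀ s hn
  have hn1 : (1 : ℝ) ≤ Real.sqrt n := Real.one_le_sqrt.2 (by exact_mod_cast hn)
  have h2 : 2 * Real.pi / Real.sqrt n ≤ 2 * Real.pi :=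
    div_le_self (by positivity) hn1
  have h3 := sq_le_sq' (abs_le.1 (h.trans h2)).1 (abs_le.1 (h.trans h2)).2
  have h4 : (n : ℝ) * (gridPoint x₀ n s - x₀) ^ 2 =
      (Real.sqrt n * (gridPoint x₀ n s - x₀)) ^ 2 := by
    rw [mul_pow, Real.sq_sqrt n.cast_nonneg]
  rw [h4]
  nlinarith [sq_nonneg (2 * (Real.sqrt n * (gridPoint x₀ n s - x₀)) - 2 * Real.pi * s)]

/-- The normalised summand at the grid point of parameter `s`, extended by zero off `[a, b]`. -/
noncomputable def gridIntegrand (a b x₀ : ℝ) (f : ℝ → ℝ) (g : ℕ → ℝ → ℂ) (n : ℕ) (s : ℝ) : ℂ :=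
  (Set.Icc a b).indicator
    (fun x => g n x * (Real.exp (n * (f x - f x₀)) : ℂ)) (gridPoint x₀ n s)

open MeasureTheory in
theorem integral_gridIntegrand (a b x₀ : ℝ) (f : ℝ → ℝ) (g : ℕ → ℝ → ℂ) {n : ℕ} (hn : 0 < n) :
    ∫ s, gridIntegrand a b x₀ f g n s =
      (∑ j ∈ Finset.Icc ⌈(n : ℝ) * a / (2 * Real.pi)⌉ ⌊(n : ℝ) * b / (2 * Real.pi)⌋,
        g n (2 * Real.pi * j / n) *
          (Real.exp ((n : ℝ) * f (2 * Real.pi * j / n)) : ℂ)) /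
      ((Real.sqrt n * Real.exp ((n : ℝ) * f x₀) : ℝ) : ℂ) := by
  have hn' : (0 : ℝ) < n := Nat.cast_pos.2 hn
  have hπ := Real.pi_pos
  have hmem : ∀ j : ℤ, 2 * Real.pi * j / n ∈ Set.Icc a b ↔
      j ∈ Finset.Icc ⌈(n : ℝ) * a / (2 * Real.pi)⌉ ⌊(n : ℝ) * b / (2 * Real.pi)⌋ := by
    intro j
    rw [Set.mem_Icc, Finset.mem_Icc, Int.ceil_le, Int.le_floor, le_div_iff₀ hn',
      div_le_iff₀ hn', div_le_iff₀ (by positivity), le_div_iff₀ (by positivity),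
      mul_comm a, mul_comm b, mul_comm (j : ℝ)]
  have h := integral_floor_mul_add_eq_sum
    (Finset.Icc ⌈(n : ℝ) * a / (2 * Real.pi)⌉ ⌊(n : ℝ) * b / (2 * Real.pi)⌋)
    (fun j => g n (2 * Real.pi * j / n) *
      (Real.exp (n * (f (2 * Real.pi * j / n) - f x₀)) : ℂ))
    (Real.sqrt_pos.2 hn') (n * x₀ / (2 * Real.pi))
  simp_rw [← hmem] at h
  simp only [gridIntegrand, gridPoint, Set.indicator_apply]
  rw [h, Complex.ofReal_mul, div_mul_eq_div_div_swap _ (Real.sqrt n : ℂ)]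
  congr 1
  rw [Finset.sum_div]
  refine Finset.sum_congr rfl fun j _ => ?_
  rw [mul_sub, Real.exp_sub, Complex.ofReal_div, ← mul_div_assoc (g n _)]

theorem measurable_gridIntegrand (a b x₀ : ℝ) (f : ℝ → ℝ) (g : ℕ → ℝ → ℂ) (n : ℕ) :
    Measurable (gridIntegrand a b x₀ f g n) := by
  have h : Measurable fun j : ℤ => (Set.Icc a b).indicator
      (fun x => g n x * (Real.exp (n * (f x - f x₀)) : ℂ)) (2 * Real.pi * j / n) :=
    measurable_from_top
  exact h.comp (by fun_prop : Measurable fun s : ℝ =>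
    ⌊Real.sqrt n * s + n * x₀ / (2 * Real.pi)⌋)

theorem norm_gridIntegrand_le {a b x₀ κ M : ℝ} {f : ℝ → ℝ} {g : ℕ → ℝ → ℂ} {n : ℕ}
    (hn : 0 < n) (hκ : 0 < κ) (hM : 0 ≤ M)
    (hfκ : ∀ x ∈ Set.Icc a b, f x - f x₀ ≤ -κ * (x - x₀) ^ 2)
    (hg : ∀ x ∈ Set.Icc a b, ‖g n x‖ ≤ M) (s : ℝ) :
    ‖gridIntegrand a b x₀ f g n s‖ ≤
      M * Real.exp (4 * Real.pi ^ 2 * κ) * Real.exp (-(2 * Real.pi ^ 2 * κ) * s ^ 2) := by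
  by_cases hx : gridPoint x₀ n s ∈ Set.Icc a b
  · rw [gridIntegrand, Set.indicator_of_mem hx, norm_mul, Complex.norm_real,
      Real.norm_of_nonneg (Real.exp_pos _).le, mul_assoc, ← Real.exp_add]
    refine mul_le_mul (hg _ hx) (Real.exp_le_exp.2 ?_) (Real.exp_pos _).le hM
    have h1 := mul_le_mul_of_nonneg_left (hfκ _ hx) (n.cast_nonneg : (0 : ℝ) ≤ n)
    have h2 := mul_le_mul_of_nonneg_left (le_mul_gridPoint_sub_sq x₀ s hn) hκ.le
    linarith
  · rw [gridIntegrand, Set.indicator_of_notMem hx, norm_zero]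
    positivity

/-- Laplace-type asymptotics for the sums
`Σ_{j ∈ ℤ, a ≤ 2πj/n ≤ b} gₙ(2πj/n) e^{n f(2πj/n)}`. -/
theorem sum_asymptotics_plain
    (a b x₀ : ℝ) (hab : a < b) (hx₀ : x₀ ∈ Set.Ioo a b)
    (f f' : ℝ → ℝ) (c : ℝ)
    (hf : ContinuousOn f (Set.Icc a b))
    (hmax : ∀ x ∈ Set.Icc a b, x ≠ x₀ → f x < f x₀)
    (hf' : ∀ᶠ x in nhds x₀, HasDerivAt f (f' x) x)
    (hf'' : HasDerivAt f' c x₀) (hc : c ≠ 0)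
    (g : ℕ → ℝ → ℂ) (ginf : ℝ → ℂ)
    (hg : ∀ n, ContinuousOn (g n) (Set.Icc a b))
    (hgu : TendstoUniformlyOn g ginf atTop (Set.Icc a b))
    (hginf : ginf x₀ ≠ 0) :
    Tendsto
      (fun n : ℕ =>
        (∑ j ∈ Finset.Icc ⌈(n : ℝ) * a / (2 * Real.pi)⌉ ⌊(n : ℝ) * b / (2 * Real.pi)⌋,
            g n (2 * Real.pi * j / n) *
              (Real.exp ((n : ℝ) * f (2 * Real.pi * j / n)) : ℂ)) /
          ((Real.sqrt n * Real.exp ((n : ℝ) * f x₀) : ℝ) : ℂ))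
      atTop
      (nhds (ginf x₀ / (Real.sqrt (-(2 * Real.pi * c)) : ℂ))) := by
  have hI : Set.Icc a b ∈ nhds x₀ := Icc_mem_nhds hx₀.1 hx₀.2
  have hπ := Real.pi_pos
  obtain ⟨hcneg, q, hqc, hq0, hq, κ, hκ, hqκ⟩ :=
    exists_quadratic_factor hx₀ hf hmax hf' hf'' hc
  have hginfc : ContinuousOn ginf (Set.Icc a b) :=
    hgu.continuousOn (Frequently.of_forall hg)
  obtain ⟨M, hM⟩ := isCompact_Icc.exists_bound_of_continuousOn hginfc
  have hM0 : 0 ≤ M := (norm_nonneg _).trans (hM x₀ (mem_of_mem_nhds hI))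
  have hlim : ∀ s : ℝ, Tendsto (fun n => gridIntegrand a b x₀ f g n s) atTop
      (nhds (ginf x₀ * (Real.exp (-(-(2 * Real.pi ^ 2 * c)) * s ^ 2) : ℂ))) := by
    intro s
    have hx := tendsto_gridPoint x₀ s
    have hgx : Tendsto (fun n => g n (gridPoint x₀ n s)) atTop (nhds (ginf x₀)) :=
      hgu.tendsto_comp (hginfc x₀ (mem_of_mem_nhds hI))
        (by rwa [nhdsWithin_eq_nhds.2 hI])
    have hqx : Tendsto (fun n : ℕ => (n : ℝ) * (f (gridPoint x₀ n s) - f x₀)) atTop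
        (nhds (-(-(2 * Real.pi ^ 2 * c)) * s ^ 2)) := by
      have h := (((hqc.continuousAt hI).tendsto.comp hx)).mul
        ((tendsto_sqrt_mul_gridPoint_sub x₀ s).pow 2)
      rw [hq0] at h
      convert! h using 2 with n
      · rw [hq, mul_pow, Real.sq_sqrt n.cast_nonneg, Function.comp_apply]
        ring
      · ring
    refine (hgx.mul ((Complex.continuous_ofReal.comp Real.continuous_exp).continuousAt.tendsto.comp
      hqx)).congr' ?_
    filter_upwards [hx hI] with n hn
    have hn' : gridPoint x₀ n s ∈ Set.Icc a b := hn
    rw [gridIntegrand, Set.indicator_of_mem hn']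
    rfl
  have hconv := MeasureTheory.tendsto_integral_filter_of_dominated_convergence
    (μ := MeasureTheory.volume) (l := atTop) (F := gridIntegrand a b x₀ f g)
    (fun s => (M + 1) * Real.exp (4 * Real.pi ^ 2 * κ) *
      Real.exp (-(2 * Real.pi ^ 2 * κ) * s ^ 2))
    (Eventually.of_forall fun n =>
      (measurable_gridIntegrand a b x₀ f g n).aestronglyMeasurable) ?_
    ((integrable_exp_neg_mul_sq (by positivity)).const_mul _)
    (Eventually.of_forall hlim)
  · have hval : ∫ s : ℝ, ginf x₀ * (Real.exp (-(-(2 * Real.pi ^ 2 * c)) * s ^ 2) : ℂ) =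
        ginf x₀ / (Real.sqrt (-(2 * Real.pi * c)) : ℂ) := by
      rw [MeasureTheory.integral_const_mul, integral_complex_ofReal, integral_gaussian,
        div_eq_mul_inv (ginf x₀), ← Complex.ofReal_inv, ← Real.sqrt_inv]
      congr 4
      field_simp
    rw [hval] at hconv
    refine hconv.congr' ?_
    filter_upwards [eventually_gt_atTop 0] with n hn
    exact integral_gridIntegrand a b x₀ f g hn
  · filter_upwards [eventually_gt_atTop 0,
      Metric.tendstoUniformlyOn_iff.1 hgu 1 one_pos] with n hn hgn
    refine Eventually.of_forall (norm_gridIntegrand_le hn hκ (by positivity)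
      (fun x hx => ?_) fun x hx => ?_)
    · rw [hq]
      exact mul_le_mul_of_nonneg_right (hqκ x hx) (sq_nonneg _)
    · have h := hgn x hx
      rw [dist_comm, dist_eq_norm] at h
      calc ‖g n x‖ = ‖ginf x + (g n x - ginf x)‖ := by rw [add_sub_cancel]
        _ ≤ ‖ginf x‖ + ‖g n x - ginf x‖ := norm_add_le _ _
        _ ≤ M + 1 := add_le_add (hM x hx) h.le
end

section
/- Let a < b be real numbers, let f : [a,b] → ℝ be a continuous function attaining its maximum at a unique point x₀ ∈ (a,b), and assume f is twice differentiable on a neighborhood of x₀ with f''(x₀) ≠ 0. Let gₙ : [a,b] → ℂ be a sequence of continuous functions converging uniformly to a function g∞ with g∞(x₀) ≠ 0. Then the alternating sums Sₙ' = Σ_{j ∈ ℤ, a ≤ 2πj/n ≤ b} (−1)^j gₙ(2πj/n) e^{n f(2πj/n)} satisfy lim_{n→∞} Sₙ' / (√n · e^{n f(x₀)}) = 0. -/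
open Filter

/-- Second-order conditions at a critical point with negative second derivative: `f` is unimodal
near `x₀` and lies below a parabola. -/
lemma exists_unimodal_of_second_deriv_neg {f f' : ℝ → ℝ} {c x₀ : ℝ}
    (hf' : ∀ᶠ x in nhds x₀, HasDerivAt f (f' x) x) (h0 : f' x₀ = 0)
    (hf'' : HasDerivAt f' c x₀) (hc : c < 0) :
    ∃ δ > 0, MonotoneOn f (Set.Icc (x₀ - δ) x₀) ∧ AntitoneOn f (Set.Icc x₀ (x₀ + δ)) ∧
      ∀ x ∈ Set.Icc (x₀ - δ) (x₀ + δ), f x ≤ f x₀ + c / 4 * (x - x₀) ^ 2 := by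
  have hlin : ∀ᶠ x in nhds x₀, |f' x - c * (x - x₀)| ≤ -c / 2 * |x - x₀| := by
    have := (hasDerivAt_iff_isLittleO.1 hf'').def (show 0 < -c / 2 by linarith)
    filter_upwards [this] with x hx
    simpa [h0, mul_comm] using hx
  obtain ⟨r, hr, hball⟩ := Metric.eventually_nhds_iff.1 (hf'.and hlin)
  set φ : ℝ → ℝ := fun x => f x - c / 4 * (x - x₀) ^ 2 with hφ
  have hnear : ∀ x ∈ Set.Icc (x₀ - r / 2) (x₀ + r / 2), dist x x₀ < r := by
    intro x hx
    rw [Real.dist_eq, abs_lt]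
    constructor <;> linarith [hx.1, hx.2]
  have hder : ∀ x ∈ Set.Icc (x₀ - r / 2) (x₀ + r / 2),
      HasDerivAt φ (f' x - c / 2 * (x - x₀)) x := by
    intro x hx
    have h1 := (hball (hnear x hx)).1
    have h2 := (((hasDerivAt_id x).sub_const x₀).pow 2).const_mul (c / 4)
    refine (h1.sub h2).congr_deriv ?_
    simp
    ring
  have hL : Set.Icc (x₀ - r / 2) x₀ ⊆ Set.Icc (x₀ - r / 2) (x₀ + r / 2) :=
    Set.Icc_subset_Icc_right (by linarith)
  have hR : Set.Icc x₀ (x₀ + r / 2) ⊆ Set.Icc (x₀ - r / 2) (x₀ + r / 2) :=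
    Set.Icc_subset_Icc_left (by linarith)
  have hmono : MonotoneOn φ (Set.Icc (x₀ - r / 2) x₀) := by
    refine monotoneOn_of_deriv_nonneg (convex_Icc _ _)
      (fun x hx => (hder x (hL hx)).continuousAt.continuousWithinAt)
      (fun x hx => (hder x (hL (interior_subset hx))).differentiableAt.differentiableWithinAt) ?_
    intro x hx
    have hx := interior_subset hx
    rw [(hder x (hL hx)).deriv]
    have h := (hball (hnear x (hL hx))).2
    rw [abs_of_nonpos (by linarith [hx.2] : x - x₀ ≤ 0)] at h
    have := (abs_le.1 h).1
    linarith
  have hanti : AntitoneOn φ (Set.Icc x₀ (x₀ + r / 2)) := by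
    refine antitoneOn_of_deriv_nonpos (convex_Icc _ _)
      (fun x hx => (hder x (hR hx)).continuousAt.continuousWithinAt)
      (fun x hx => (hder x (hR (interior_subset hx))).differentiableAt.differentiableWithinAt) ?_
    intro x hx
    have hx := interior_subset hx
    rw [(hder x (hR hx)).deriv]
    have h := (hball (hnear x (hR hx))).2
    rw [abs_of_nonneg (by linarith [hx.1] : 0 ≤ x - x₀)] at h
    have := (abs_le.1 h).2
    linarith
  refine ⟨r / 2, by linarith, ?_, ?_, ?_⟩
  · intro x hx y hy hxy
    have h := hmono hx hy hxy
    simp only [hφ] at h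
    have h2 : (y - x₀) ^ 2 ≤ (x - x₀) ^ 2 := by nlinarith [hx.2, hy.2]
    nlinarith
  · intro x hx y hy hxy
    have h := hanti hx hy hxy
    simp only [hφ] at h
    have h2 : (x - x₀) ^ 2 ≤ (y - x₀) ^ 2 := by nlinarith [hx.1, hy.1]
    nlinarith
  · intro x hx
    rcases le_total x x₀ with hxx | hxx
    · have h := hmono ⟨hx.1, hxx⟩ ⟨by linarith, le_rfl⟩ hxx
      simp only [hφ, sub_self] at h
      linarith
    · have h := hanti ⟨le_rfl, by linarith⟩ ⟨hxx, hx.2⟩ hxx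
      simp only [hφ, sub_self] at h
      linarith

lemma Int.Icc_succ_right_eq_insert {p q : ℤ} (h : p ≤ q) :
    Finset.Icc p (q + 1) = insert (q + 1) (Finset.Icc p q) := by
  ext j
  simp only [Finset.mem_Icc, Finset.mem_insert]
  omega

lemma norm_neg_one_zpow (j : ℤ) : ‖(-1 : ℂ) ^ j‖ = 1 := by
  simp [norm_zpow]

/-- The Leibniz bound for alternating sums of nonnegative antitone sequences. -/
lemma norm_alternating_sum_le {p q : ℤ} (hpq : p ≤ q) {v : ℤ → ℝ}
    (hv : AntitoneOn v (Set.Icc p q)) (h0 : 0 ≤ v q) :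
    ‖∑ j ∈ Finset.Icc p q, (-1 : ℂ) ^ j * (v j : ℂ)‖ ≤ v p := by
  have hp0 : 0 ≤ v p := h0.trans (hv ⟨le_rfl, hpq⟩ ⟨hpq, le_rfl⟩ hpq)
  have key : ∀ r, p ≤ r → r ≤ q →
      ‖∑ j ∈ Finset.Icc p r, (-1 : ℂ) ^ j * (v j : ℂ) - (-1 : ℂ) ^ r * ((v r / 2 : ℝ) : ℂ)‖
        ≤ v p - v r / 2 := by
    intro r hr
    induction r, hr using Int.leInduction with
    | base =>
      intro _
      have : (-1 : ℂ) ^ p * (v p : ℂ) - (-1 : ℂ) ^ p * ((v p / 2 : ℝ) : ℂ)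
        = (-1 : ℂ) ^ p * ((v p / 2 : ℝ) : ℂ) := by push_cast; ring
      rw [Finset.Icc_self, Finset.sum_singleton, this, norm_mul, norm_neg_one_zpow,
        Complex.norm_real, Real.norm_of_nonneg (by linarith)]
      linarith
    | succ r hr ih =>
      intro hrq
      have hd : v (r + 1) ≤ v r := hv ⟨hr, by omega⟩ ⟨by omega, hrq⟩ (by omega)
      have hsplit : ∑ j ∈ Finset.Icc p (r + 1), (-1 : ℂ) ^ j * (v j : ℂ)
            - (-1 : ℂ) ^ (r + 1) * ((v (r + 1) / 2 : ℝ) : ℂ)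
          = (∑ j ∈ Finset.Icc p r, (-1 : ℂ) ^ j * (v j : ℂ)
            - (-1 : ℂ) ^ r * ((v r / 2 : ℝ) : ℂ))
            + (-1 : ℂ) ^ r * (((v r - v (r + 1)) / 2 : ℝ) : ℂ) := by
        rw [Int.Icc_succ_right_eq_insert hr, Finset.sum_insert (by simp),
          zpow_add₀ (by norm_num), zpow_one]
        push_cast
        ring
      rw [hsplit]
      refine (norm_add_le _ _).trans ?_
      rw [norm_mul, norm_neg_one_zpow, Complex.norm_real, Real.norm_of_nonneg (by linarith)]
      linarith [ih (by omega)]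
  have h1 := key q hpq le_rfl
  have h2 := norm_le_norm_sub_add (∑ j ∈ Finset.Icc p q, (-1 : ℂ) ^ j * (v j : ℂ))
    ((-1 : ℂ) ^ q * ((v q / 2 : ℝ) : ℂ))
  rw [norm_mul, norm_neg_one_zpow, Complex.norm_real, Real.norm_of_nonneg (by linarith)] at h2
  linarith

lemma sum_lorentzian_le {p q : ℤ} {s L : ℝ} (hL : 2 ≤ L) (hs : s ≤ p) (hpq : p ≤ q) :
    ∑ j ∈ Finset.Icc p q, L ^ 2 / (L ^ 2 + ((j : ℝ) - s) ^ 2) ≤ 4 * L := by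
  have term : ∀ t : ℝ, 0 ≤ t →
      L ^ 2 / (L ^ 2 + t ^ 2) ≤ 2 * L ^ 2 * (1 / (L + t - 1) - 1 / (L + t)) := by
    intro t ht
    have h1 : 0 < L + t - 1 := by linarith
    have h2 : 0 < L + t := by linarith
    have : 2 * L ^ 2 * (1 / (L + t - 1) - 1 / (L + t))
        = 2 * L ^ 2 / ((L + t - 1) * (L + t)) := by
      field_simp
      ring
    rw [this, div_le_div_iff₀ (by positivity) (by positivity)]
    have : (L + t - 1) * (L + t) ≤ 2 * (L ^ 2 + t ^ 2) := by nlinarith [sq_nonneg (L - t)]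
    nlinarith [sq_nonneg L]
  have key : ∀ r, p ≤ r → ∑ j ∈ Finset.Icc p r, L ^ 2 / (L ^ 2 + ((j : ℝ) - s) ^ 2)
      ≤ 2 * L ^ 2 * (1 / (L + (p - s) - 1) - 1 / (L + (r - s))) := by
    intro r hr
    induction r, hr using Int.leInduction with
    | base =>
      rw [Finset.Icc_self, Finset.sum_singleton]
      exact term _ (by linarith)
    | succ r hr ih =>
      have hr' : (p : ℝ) ≤ r := by exact_mod_cast hr
      rw [Int.Icc_succ_right_eq_insert hr, Finset.sum_insert (by simp)]
      have h := term (((r + 1 : ℤ) : ℝ) - s) (by push_cast; linarith)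
      have e : L + (((r + 1 : ℤ) : ℝ) - s) - 1 = L + (r - s) := by push_cast; ring
      rw [e] at h
      linarith
  refine (key q hpq).trans ?_
  have hq' : (p : ℝ) ≤ q := by exact_mod_cast hpq
  have h1 : 1 / (L + ((p : ℝ) - s) - 1) ≤ 2 / L := by
    rw [div_le_div_iff₀ (by linarith) (by linarith)]
    linarith
  have h2 : 0 ≤ 1 / (L + ((q : ℝ) - s)) := one_div_nonneg.2 (by linarith)
  calc _ ≤ 2 * L ^ 2 * (2 / L) := by gcongr; linarith
    _ = 4 * L := by
      field_simp
      ring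

lemma norm_alternating_weighted_sum_le_of_antitoneOn {p q : ℤ} {s L ε : ℝ} {G : ℂ}
    (hL : 2 ≤ L) (hε : 0 ≤ ε) (hs : s ≤ p) {v : ℤ → ℝ} {w : ℤ → ℂ}
    (hv : AntitoneOn v (Set.Icc p q)) (h0 : ∀ j ∈ Finset.Icc p q, 0 ≤ v j)
    (hvL : ∀ j ∈ Finset.Icc p q, v j ≤ L ^ 2 / (L ^ 2 + ((j : ℝ) - s) ^ 2))
    (hw : ∀ j ∈ Finset.Icc p q, ‖w j - G‖ ≤ ε) :
    ‖∑ j ∈ Finset.Icc p q, (-1 : ℂ) ^ j * w j * (v j : ℂ)‖ ≤ ‖G‖ + ε * (4 * L) := by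
  rcases lt_or_ge q p with hqp | hpq
  · rw [Finset.Icc_eq_empty (by omega), Finset.sum_empty, norm_zero]
    positivity
  have hsplit : ∑ j ∈ Finset.Icc p q, (-1 : ℂ) ^ j * w j * (v j : ℂ)
      = G * ∑ j ∈ Finset.Icc p q, (-1 : ℂ) ^ j * (v j : ℂ)
        + ∑ j ∈ Finset.Icc p q, (-1 : ℂ) ^ j * (w j - G) * (v j : ℂ) := by
    rw [Finset.mul_sum, ← Finset.sum_add_distrib]
    exact Finset.sum_congr rfl fun j _ => by ring
  rw [hsplit]
  refine (norm_add_le _ _).trans (add_le_add ?_ ?_)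
  · rw [norm_mul]
    have h1 := norm_alternating_sum_le hpq hv (h0 q (by simp [hpq]))
    have h2 : v p ≤ 1 := (hvL p (by simp [hpq])).trans
      (div_le_one_of_le₀ (by nlinarith [sq_nonneg ((p : ℝ) - s)]) (by positivity))
    exact mul_le_of_le_one_right (norm_nonneg _) (h1.trans h2)
  · calc _ ≤ ∑ j ∈ Finset.Icc p q, ε * (L ^ 2 / (L ^ 2 + ((j : ℝ) - s) ^ 2)) := by
          refine norm_sum_le_of_le _ fun j hj => ?_
          rw [norm_mul, norm_mul, norm_neg_one_zpow, one_mul, Complex.norm_real,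
            Real.norm_of_nonneg (h0 j hj)]
          exact mul_le_mul (hw j hj) (hvL j hj) (h0 j hj) hε
      _ ≤ ε * (4 * L) := by
          rw [← Finset.mul_sum]
          exact mul_le_mul_of_nonneg_left (sum_lorentzian_le hL hs hpq) hε

lemma norm_alternating_weighted_sum_le_of_monotoneOn {p q : ℤ} {s L ε : ℝ} {G : ℂ}
    (hL : 2 ≤ L) (hε : 0 ≤ ε) (hs : q ≤ s) {v : ℤ → ℝ} {w : ℤ → ℂ}
    (hv : MonotoneOn v (Set.Icc p q)) (h0 : ∀ j ∈ Finset.Icc p q, 0 ≤ v j)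
    (hvL : ∀ j ∈ Finset.Icc p q, v j ≤ L ^ 2 / (L ^ 2 + ((j : ℝ) - s) ^ 2))
    (hw : ∀ j ∈ Finset.Icc p q, ‖w j - G‖ ≤ ε) :
    ‖∑ j ∈ Finset.Icc p q, (-1 : ℂ) ^ j * w j * (v j : ℂ)‖ ≤ ‖G‖ + ε * (4 * L) := by
  have hmem : ∀ j ∈ Finset.Icc (-q) (-p), -j ∈ Finset.Icc p q := by
    intro j hj
    simp only [Finset.mem_Icc] at hj ⊢
    omega
  have hrefl : ∑ j ∈ Finset.Icc p q, (-1 : ℂ) ^ j * w j * (v j : ℂ)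
      = ∑ j ∈ Finset.Icc (-q) (-p), (-1 : ℂ) ^ j * w (-j) * (v (-j) : ℂ) := by
    refine Finset.sum_nbij' (fun j => -j) (fun j => -j) ?_ hmem (by simp) (by simp) ?_
    · intro j hj
      simp only [Finset.mem_Icc] at hj ⊢
      omega
    · intro j _
      rw [neg_neg, zpow_neg, ← inv_zpow]
      norm_num
  rw [hrefl]
  refine norm_alternating_weighted_sum_le_of_antitoneOn (s := -s)
    (v := fun j => v (-j)) (w := fun j => w (-j)) hL hε (by push_cast; linarith) ?_
    (fun j hj => h0 _ (hmem j hj)) (fun j hj => ?_) (fun j hj => hw _ (hmem j hj))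
  · intro i hi j hj hij
    exact hv (Finset.mem_Icc.1 (hmem j (Finset.mem_Icc.2 hj)))
      (Finset.mem_Icc.1 (hmem i (Finset.mem_Icc.2 hi))) (by omega)
  · refine (hvL _ (hmem j hj)).trans_eq ?_
    push_cast
    ring

lemma norm_alternating_weighted_sum_le_of_unimodal {p q : ℤ} {s L ε : ℝ} {G : ℂ}
    (hL : 2 ≤ L) (hε : 0 ≤ ε) {v : ℤ → ℝ} {w : ℤ → ℂ}
    (hmono : MonotoneOn v {j | j ∈ Set.Icc p q ∧ (j : ℝ) ≤ s})
    (hanti : AntitoneOn v {j | j ∈ Set.Icc p q ∧ s ≤ (j : ℝ)})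
    (h0 : ∀ j ∈ Finset.Icc p q, 0 ≤ v j)
    (hvL : ∀ j ∈ Finset.Icc p q, v j ≤ L ^ 2 / (L ^ 2 + ((j : ℝ) - s) ^ 2))
    (hw : ∀ j ∈ Finset.Icc p q, ‖w j - G‖ ≤ ε) :
    ‖∑ j ∈ Finset.Icc p q, (-1 : ℂ) ^ j * w j * (v j : ℂ)‖ ≤ 2 * (‖G‖ + ε * (4 * L)) := by
  have hs1 : s ≤ max p ⌈s⌉ := by
    push_cast
    exact le_max_of_le_right (Int.le_ceil s)
  have hs2 : ((min q (⌈s⌉ - 1) : ℤ) : ℝ) ≤ s := by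
    push_cast
    exact min_le_of_right_le (by linarith [Int.ceil_lt_add_one s])
  have hsubR : Finset.Icc (max p ⌈s⌉) q ⊆ Finset.Icc p q :=
    Finset.Icc_subset_Icc_left (le_max_left _ _)
  have hsubL : Finset.Icc p (min q (⌈s⌉ - 1)) ⊆ Finset.Icc p q :=
    Finset.Icc_subset_Icc_right (min_le_left _ _)
  have hunion : Finset.Icc p q
      = Finset.Icc p (min q (⌈s⌉ - 1)) ∪ Finset.Icc (max p ⌈s⌉) q := by
    ext j
    simp only [Finset.mem_union, Finset.mem_Icc]
    omega
  have hdisj : Disjoint (Finset.Icc p (min q (⌈s⌉ - 1))) (Finset.Icc (max p ⌈s⌉) q) := by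
    rw [Finset.disjoint_left]
    intro j
    simp only [Finset.mem_Icc]
    omega
  rw [hunion, Finset.sum_union hdisj, two_mul]
  refine (norm_add_le _ _).trans (add_le_add ?_ ?_)
  · refine norm_alternating_weighted_sum_le_of_monotoneOn hL hε hs2 (hmono.mono fun j hj => ?_)
      (fun j hj => h0 j (hsubL hj)) (fun j hj => hvL j (hsubL hj)) (fun j hj => hw j (hsubL hj))
    exact ⟨Finset.mem_Icc.1 (hsubL (Finset.mem_Icc.2 hj)),
      (Int.cast_le.2 hj.2).trans hs2⟩
  · refine norm_alternating_weighted_sum_le_of_antitoneOn hL hε hs1 (hanti.mono fun j hj => ?_)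
      (fun j hj => h0 j (hsubR hj)) (fun j hj => hvL j (hsubR hj)) (fun j hj => hw j (hsubR hj))
    exact ⟨Finset.mem_Icc.1 (hsubR (Finset.mem_Icc.2 hj)),
      hs1.trans (Int.cast_le.2 hj.1)⟩

lemma exp_neg_le_lorentzian {L t : ℝ} (hL : 0 < L) :
    Real.exp (-(t ^ 2 / L ^ 2)) ≤ L ^ 2 / (L ^ 2 + t ^ 2) := by
  have h := Real.add_one_le_exp (t ^ 2 / L ^ 2)
  rw [Real.exp_neg, inv_le_comm₀ (Real.exp_pos _) (by positivity), inv_div, add_div,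
    div_self (by positivity)]
  linarith

/-- Away from a strict maximum a continuous function on a compact interval is bounded away from
the maximal value. -/
lemma exists_gap_of_strict_max {f : ℝ → ℝ} {a b x₀ δ : ℝ} (hδ : 0 < δ)
    (hf : ContinuousOn f (Set.Icc a b)) (hmax : ∀ x ∈ Set.Icc a b, x ≠ x₀ → f x < f x₀) :
    ∃ η > 0, ∀ x ∈ Set.Icc a b, δ ≤ |x - x₀| → f x ≤ f x₀ - η := by
  have hK : IsCompact (Set.Icc a b ∩ {x | δ ≤ |x - x₀|}) :=
    isCompact_Icc.inter_right (isClosed_le continuous_const (by fun_prop))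
  rcases (Set.Icc a b ∩ {x | δ ≤ |x - x₀|}).eq_empty_or_nonempty with he | hne
  · exact ⟨1, one_pos, fun x hx hxd => (he.le ⟨hx, hxd⟩).elim⟩
  · obtain ⟨y, hy, hymax⟩ := hK.exists_isMaxOn hne (hf.mono Set.inter_subset_left)
    have hyne : y ≠ x₀ := by
      rintro rfl
      have := hy.2
      simp only [Set.mem_ofPred_eq, sub_self, abs_zero] at this
      linarith
    refine ⟨f x₀ - f y, by linarith [hmax y hy.1 hyne], fun x hx hxd => ?_⟩
    have : f x ≤ f y := hymax ⟨hx, hxd⟩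
    linarith

lemma second_deriv_neg_of_strict_max {f f' : ℝ → ℝ} {a b x₀ c : ℝ} (hx₀ : x₀ ∈ Set.Ioo a b)
    (hmax : ∀ x ∈ Set.Icc a b, x ≠ x₀ → f x < f x₀)
    (hf' : ∀ᶠ x in nhds x₀, HasDerivAt f (f' x) x)
    (hf'' : HasDerivAt f' c x₀) (hc : c ≠ 0) : f' x₀ = 0 ∧ c < 0 := by
  have hloc : IsLocalMax f x₀ := by
    filter_upwards [Icc_mem_nhds hx₀.1 hx₀.2] with x hx
    rcases eq_or_ne x x₀ with rfl | hne
    · exact le_rfl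
    · exact (hmax x hx hne).le
  have h0 : f' x₀ = 0 := hloc.hasDerivAt_eq_zero hf'.self_of_nhds
  refine ⟨h0, lt_of_le_of_ne (not_lt.1 fun hpos => ?_) hc⟩
  obtain ⟨δ, hδ, -, -, hpar⟩ := exists_unimodal_of_second_deriv_neg (f := fun x => -f x)
    (f' := fun x => -f' x) (c := -c) (x₀ := x₀) (hf'.mono fun x hx => hx.neg)
    (by simp [h0]) hf''.neg (by linarith)
  have hx1 : x₀ < min b (x₀ + δ) := lt_min hx₀.2 (by linarith)
  have h1 := hmax (min b (x₀ + δ)) ⟨by linarith [hx₀.1], min_le_left _ _⟩ hx1.ne'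
  have h2 := hpar (min b (x₀ + δ)) ⟨by linarith, min_le_right _ _⟩
  nlinarith [sq_nonneg (min b (x₀ + δ) - x₀)]

lemma tendsto_linear_mul_exp_neg_atTop (A B : ℝ) {η : ℝ} (hη : 0 < η) :
    Tendsto (fun n : ℕ => (A * n + B) * Real.exp (-(η * n))) atTop (nhds 0) := by
  have h1 : Tendsto (fun n : ℕ => η * (n : ℝ)) atTop atTop :=
    tendsto_natCast_atTop_atTop.const_mul_atTop hη
  have h2 := (Real.tendsto_pow_mul_exp_neg_atTop_nhds_zero 1).comp h1
  have h3 := (Real.tendsto_pow_mul_exp_neg_atTop_nhds_zero 0).comp h1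
  have h4 := (h2.const_mul (A / η)).add (h3.const_mul B)
  simp only [mul_zero, add_zero] at h4
  refine h4.congr fun n => ?_
  simp only [Function.comp]
  field_simp

/-- The alternating sums
`Σ_{j ∈ ℤ, a ≤ 2πj/n ≤ b} (−1)^j gₙ(2πj/n) e^{n f(2πj/n)}` are negligible
compared to `√n e^{n f(x₀)}`. -/
theorem sum_asymptotics_alternating
    (a b x₀ : ℝ) (hab : a < b) (hx₀ : x₀ ∈ Set.Ioo a b)
    (f f' : ℝ → ℝ) (c : ℝ)
    (hf : ContinuousOn f (Set.Icc a b))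
    (hmax : ∀ x ∈ Set.Icc a b, x ≠ x₀ → f x < f x₀)
    (hf' : ∀ᶠ x in nhds x₀, HasDerivAt f (f' x) x)
    (hf'' : HasDerivAt f' c x₀) (hc : c ≠ 0)
    (g : ℕ → ℝ → ℂ) (ginf : ℝ → ℂ)
    (hg : ∀ n, ContinuousOn (g n) (Set.Icc a b))
    (hgu : TendstoUniformlyOn g ginf atTop (Set.Icc a b))
    (hginf : ginf x₀ ≠ 0) :
    Tendsto
      (fun n : ℕ =>
        (∑ j ∈ Finset.Icc ⌈(n : ℝ) * a / (2 * Real.pi)⌉ ⌊(n : ℝ) * b / (2 * Real.pi)⌋,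
            ((-1 : ℂ) ^ j) * g n (2 * Real.pi * j / n) *
              (Real.exp ((n : ℝ) * f (2 * Real.pi * j / n)) : ℂ)) /
          ((Real.sqrt n * Real.exp ((n : ℝ) * f x₀) : ℝ) : ℂ))
      atTop
      (nhds 0) := by
  obtain ⟨h0, hcneg⟩ := second_deriv_neg_of_strict_max hx₀ hmax hf' hf'' hc
  obtain ⟨δ₀, hδ₀, hmono, hanti, hpar⟩ := exists_unimodal_of_second_deriv_neg hf' h0 hf'' hcneg
  have hπ := Real.pi_pos
  have hgc : ContinuousOn ginf (Set.Icc a b) := hgu.continuousOn (Frequently.of_forall hg)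
  obtain ⟨M, hM⟩ := isCompact_Icc.exists_bound_of_continuousOn hgc
  have hx₀' : x₀ ∈ Set.Icc a b := Set.Ioo_subset_Icc_self hx₀
  have hM0 : 0 ≤ M := (norm_nonneg _).trans (hM x₀ hx₀')
  set κ : ℝ := -c / 4 with hκ
  have hκ0 : 0 < κ := by linarith
  set lam : ℝ := 1 / (2 * Real.pi * Real.sqrt κ) with hlam
  have hlam0 : 0 < lam := by positivity
  rw [Metric.tendsto_atTop']
  intro ε hε
  set e : ℝ := ε / (32 * lam) with he
  have he0 : 0 < e := by positivity
  have hgat : ContinuousAt ginf x₀ := hgc.continuousAt (Icc_mem_nhds hx₀.1 hx₀.2)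
  obtain ⟨δ₁, hδ₁, hclose⟩ := Metric.continuousAt_iff.1 hgat e he0
  obtain ⟨δ, hδ, hδδ₀, hδδ₁, hδa, hδb⟩ :
      ∃ δ > 0, δ ≤ δ₀ ∧ δ < δ₁ ∧ a ≤ x₀ - δ ∧ x₀ + δ ≤ b := by
    refine ⟨min (min δ₀ (δ₁ / 2)) (min (x₀ - a) (b - x₀)), ?_, ?_, ?_, ?_, ?_⟩
    · have := hx₀.1
      have := hx₀.2
      simp only [gt_iff_lt, lt_min_iff]
      refine ⟨⟨hδ₀, by linarith⟩, by linarith, by linarith⟩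
    · exact (min_le_left _ _).trans (min_le_left _ _)
    · have : min (min δ₀ (δ₁ / 2)) (min (x₀ - a) (b - x₀)) ≤ δ₁ / 2 :=
        (min_le_left _ _).trans (min_le_right _ _)
      linarith
    · have : min (min δ₀ (δ₁ / 2)) (min (x₀ - a) (b - x₀)) ≤ x₀ - a :=
        (min_le_right _ _).trans (min_le_left _ _)
      linarith
    · have : min (min δ₀ (δ₁ / 2)) (min (x₀ - a) (b - x₀)) ≤ b - x₀ :=
        (min_le_right _ _).trans (min_le_right _ _)
      linarith
  obtain ⟨η, hη, hgap⟩ := exists_gap_of_strict_max hδ hf hmax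
  have hsqrt : Tendsto (fun n : ℕ => Real.sqrt n) atTop atTop :=
    Real.tendsto_sqrt_atTop.comp tendsto_natCast_atTop_atTop
  have ev1 := hsqrt.eventually_ge_atTop (2 / lam)
  have ev2 := hsqrt.eventually_gt_atTop ((2 * ‖ginf x₀‖ + 1) / (ε / 2))
  have ev3 := (tendsto_linear_mul_exp_neg_atTop ((M + 1) * (b - a)) (M + 1) hη).eventually
    (gt_mem_nhds one_pos)
  have ev4 := Metric.tendstoUniformlyOn_iff.1 hgu (min e 1) (lt_min he0 one_pos)
  obtain ⟨N, hN⟩ := eventually_atTop.1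
    (ev1.and (ev2.and (ev3.and (ev4.and (eventually_gt_atTop 0)))))
  refine ⟨N, fun n hn => ?_⟩
  obtain ⟨hn1, hn2, hn3, hn4, hn0⟩ := hN n hn.le
  have hnpos : (0 : ℝ) < n := by exact_mod_cast hn0
  have hsqpos : 0 < Real.sqrt n := Real.sqrt_pos.2 hnpos
  set L : ℝ := Real.sqrt n * lam with hLdef
  have hL2 : 2 ≤ L := (div_le_iff₀ hlam0).1 hn1
  set s : ℝ := n * x₀ / (2 * Real.pi) with hs
  set X : ℤ → ℝ := fun j => 2 * Real.pi * j / n with hX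
  have hXle : ∀ (j : ℤ) (y : ℝ), X j ≤ y ↔ (j : ℝ) ≤ n * y / (2 * Real.pi) := by
    intro j y
    rw [hX, div_le_iff₀ hnpos, le_div_iff₀ (by positivity), mul_comm (j : ℝ), mul_comm y]
  have hleX : ∀ (j : ℤ) (y : ℝ), y ≤ X j ↔ n * y / (2 * Real.pi) ≤ (j : ℝ) := by
    intro j y
    rw [hX, le_div_iff₀ hnpos, div_le_iff₀ (by positivity), mul_comm (j : ℝ), mul_comm y]
  have hXmono : ∀ i j : ℤ, i ≤ j → X i ≤ X j := by
    intro i j hij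
    have : (i : ℝ) ≤ j := by exact_mod_cast hij
    simp only [hX]
    gcongr
  have hmemX : ∀ (j : ℤ) (y z : ℝ),
      j ∈ Finset.Icc ⌈(n : ℝ) * y / (2 * Real.pi)⌉ ⌊(n : ℝ) * z / (2 * Real.pi)⌋
        ↔ X j ∈ Set.Icc y z := by
    intro j y z
    rw [Finset.mem_Icc, Int.ceil_le, Int.le_floor, Set.mem_Icc, hXle, hleX]
  set J := Finset.Icc ⌈(n : ℝ) * a / (2 * Real.pi)⌉ ⌊(n : ℝ) * b / (2 * Real.pi)⌋ with hJ
  set p : ℤ := ⌈(n : ℝ) * (x₀ - δ) / (2 * Real.pi)⌉ with hp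
  set q : ℤ := ⌊(n : ℝ) * (x₀ + δ) / (2 * Real.pi)⌋ with hq
  set v : ℤ → ℝ := fun j => Real.exp (n * (f (X j) - f x₀)) with hv
  have hquot : (∑ j ∈ J, ((-1 : ℂ) ^ j) * g n (2 * Real.pi * j / n) *
        (Real.exp ((n : ℝ) * f (2 * Real.pi * j / n)) : ℂ)) /
          ((Real.sqrt n * Real.exp ((n : ℝ) * f x₀) : ℝ) : ℂ)
      = (∑ j ∈ J, (-1 : ℂ) ^ j * g n (X j) * (v j : ℂ)) / (Real.sqrt n : ℂ) := by
    have hE : (Real.exp ((n : ℝ) * f x₀) : ℂ) ≠ 0 := by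
      exact_mod_cast (Real.exp_pos _).ne'
    have hv' : ∀ j, (Real.exp ((n : ℝ) * f (X j)) : ℂ)
        = (v j : ℂ) * (Real.exp ((n : ℝ) * f x₀) : ℂ) := by
      intro j
      rw [← Complex.ofReal_mul, hv, ← Real.exp_add]
      congr 2
      ring
    have hsum : (∑ j ∈ J, ((-1 : ℂ) ^ j) * g n (2 * Real.pi * j / n) *
        (Real.exp ((n : ℝ) * f (2 * Real.pi * j / n)) : ℂ))
        = (∑ j ∈ J, (-1 : ℂ) ^ j * g n (X j) * (v j : ℂ))
          * (Real.exp ((n : ℝ) * f x₀) : ℂ) := by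
      rw [Finset.sum_mul]
      refine Finset.sum_congr rfl fun j _ => ?_
      rw [mul_assoc _ (v j : ℂ), ← hv' j]
    rw [hsum, Complex.ofReal_mul, mul_div_mul_right _ _ hE]
  have hsub : Finset.Icc p q ⊆ J := by
    intro j hj
    rw [hmemX] at hj ⊢
    exact ⟨hδa.trans hj.1, hj.2.trans hδb⟩
  have hnear : ‖∑ j ∈ Finset.Icc p q, (-1 : ℂ) ^ j * g n (X j) * (v j : ℂ)‖
      ≤ 2 * (‖ginf x₀‖ + (2 * e) * (4 * L)) := by
    refine norm_alternating_weighted_sum_le_of_unimodal (s := s) (w := fun j => g n (X j))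
      hL2 (by positivity) ?_ ?_ (fun j _ => (Real.exp_pos _).le) ?_ ?_
    · intro i hi j hj hij
      have hi' := (hmemX i _ _).1 (Finset.mem_Icc.2 hi.1)
      have hj' := (hmemX j _ _).1 (Finset.mem_Icc.2 hj.1)
      have := hmono ⟨by linarith [hi'.1], (hXle i x₀).2 hi.2⟩
        ⟨by linarith [hj'.1], (hXle j x₀).2 hj.2⟩ (hXmono i j hij)
      simp only [hv]
      gcongr
    · intro i hi j hj hij
      have hi' := (hmemX i _ _).1 (Finset.mem_Icc.2 hi.1)
      have hj' := (hmemX j _ _).1 (Finset.mem_Icc.2 hj.1)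
      have := hanti ⟨(hleX i x₀).2 hi.2, by linarith [hi'.2]⟩
        ⟨(hleX j x₀).2 hj.2, by linarith [hj'.2]⟩ (hXmono i j hij)
      simp only [hv]
      gcongr
    · intro j hj
      have hj' := (hmemX j _ _).1 hj
      refine le_trans ?_ (exp_neg_le_lorentzian (by linarith))
      have h1 := hpar (X j) ⟨by linarith [hj'.1], by linarith [hj'.2]⟩
      have h2 : ((j : ℝ) - s) ^ 2 / L ^ 2 = n * (κ * (X j - x₀) ^ 2) := by
        rw [hLdef, hlam, hs, hX, mul_pow, div_pow, mul_pow, Real.sq_sqrt hnpos.le,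
          Real.sq_sqrt hκ0.le]
        field_simp
      rw [h2]
      refine Real.exp_le_exp.2 ?_
      rw [← mul_neg]
      refine mul_le_mul_of_nonneg_left ?_ hnpos.le
      rw [hκ]
      linarith
    · intro j hj
      have hJX := (hmemX j _ _).1 (hsub hj)
      have hj' := (hmemX j _ _).1 hj
      have h1 : dist (ginf (X j)) (g n (X j)) < e :=
        (hn4 (X j) hJX).trans_le (min_le_left _ _)
      have h2 : dist (ginf (X j)) (ginf x₀) < e := by
        refine hclose (lt_of_le_of_lt ?_ hδδ₁)
        rw [Real.dist_eq, abs_le]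
        constructor <;> linarith [hj'.1, hj'.2]
      rw [← dist_eq_norm]
      linarith [dist_triangle_left (g n (X j)) (ginf x₀) (ginf (X j))]
  have hfar : ‖∑ j ∈ J \ Finset.Icc p q, (-1 : ℂ) ^ j * g n (X j) * (v j : ℂ)‖ ≤ 1 := by
    have hterm : ∀ j ∈ J \ Finset.Icc p q,
        ‖(-1 : ℂ) ^ j * g n (X j) * (v j : ℂ)‖ ≤ (M + 1) * Real.exp (-(η * n)) := by
      intro j hj
      rw [Finset.mem_sdiff, hmemX, hmemX] at hj
      have hg1 : ‖g n (X j)‖ ≤ M + 1 := by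
        have h1 : dist (ginf (X j)) (g n (X j)) < 1 :=
          (hn4 (X j) hj.1).trans_le (min_le_right _ _)
        rw [dist_comm, dist_eq_norm] at h1
        linarith [hM (X j) hj.1, norm_le_norm_sub_add (g n (X j)) (ginf (X j))]
      have hd : δ ≤ |X j - x₀| := by
        by_contra! hlt
        rw [abs_lt] at hlt
        exact hj.2 ⟨by linarith, by linarith⟩
      have hv1 : v j ≤ Real.exp (-(η * n)) := by
        refine Real.exp_le_exp.2 ?_
        nlinarith [hgap (X j) hj.1 hd]
      rw [norm_mul, norm_mul, norm_neg_one_zpow, one_mul, Complex.norm_real,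
        Real.norm_of_nonneg (Real.exp_pos _).le]
      exact mul_le_mul hg1 hv1 (Real.exp_pos _).le (by linarith)
    have hcard : (((J \ Finset.Icc p q).card : ℕ) : ℝ) ≤ (b - a) * n + 1 := by
      have h1 : (((J \ Finset.Icc p q).card : ℕ) : ℝ) ≤ (J.card : ℝ) := by
        exact_mod_cast Finset.card_le_card Finset.sdiff_subset
      refine h1.trans ?_
      have hba : 0 ≤ (b - a) * n := mul_nonneg (by linarith) hnpos.le
      have h2 := Int.floor_le ((n : ℝ) * b / (2 * Real.pi))
      have h3 := Int.le_ceil ((n : ℝ) * a / (2 * Real.pi))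
      have h4 : (n : ℝ) * b / (2 * Real.pi) - (n : ℝ) * a / (2 * Real.pi) ≤ (b - a) * n := by
        rw [← sub_div, div_le_iff₀ (by positivity)]
        nlinarith [Real.pi_gt_three]
      rw [hJ, Int.card_Icc]
      rcases le_total 0 (⌊(n : ℝ) * b / (2 * Real.pi)⌋ + 1 - ⌈(n : ℝ) * a / (2 * Real.pi)⌉)
        with hc0 | hc0
      · have : (((⌊(n : ℝ) * b / (2 * Real.pi)⌋ + 1
            - ⌈(n : ℝ) * a / (2 * Real.pi)⌉).toNat : ℤ) : ℝ)
            = ((⌊(n : ℝ) * b / (2 * Real.pi)⌋ + 1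
            - ⌈(n : ℝ) * a / (2 * Real.pi)⌉ : ℤ) : ℝ) := by rw [Int.toNat_of_nonneg hc0]
        rw [Int.cast_natCast] at this
        rw [this]
        push_cast
        linarith
      · rw [Int.toNat_of_nonpos hc0]
        push_cast
        linarith
    refine (norm_sum_le_of_le _ hterm).trans ?_
    rw [Finset.sum_const, nsmul_eq_mul]
    calc _ ≤ ((b - a) * n + 1) * ((M + 1) * Real.exp (-(η * n))) := by gcongr
      _ = ((M + 1) * (b - a) * n + (M + 1)) * Real.exp (-(η * n)) := by ring
      _ ≤ 1 := hn3.le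
  rw [dist_zero_right, hquot, norm_div, Complex.norm_real, Real.norm_of_nonneg hsqpos.le,
    div_lt_iff₀ hsqpos, ← Finset.sum_sdiff hsub]
  have hG : 2 * ‖ginf x₀‖ + 1 < ε / 2 * Real.sqrt n := by
    rw [div_lt_iff₀ (by positivity)] at hn2
    linarith
  have hL : 16 * e * L = ε / 2 * Real.sqrt n := by
    rw [he, hLdef]
    field_simp
    norm_num
  calc _ ≤ 1 + 2 * (‖ginf x₀‖ + (2 * e) * (4 * L)) :=
        (norm_add_le _ _).trans (add_le_add hfar hnear)
    _ < ε * Real.sqrt n := by linarith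
end
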